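/- Let P be a finite, non-collinear subset of the Euclidean plane ℝ². Then the number of unordered pairs {p, p'} of distinct points of P for which V_P(p) ∩ V_P(p') is an unbounded Voronoi edge (contains more than one point and is unbounded) equals the number of points of P on the boundary of P, i.e. equals (Bd(P)).ncard. -/

import Mathlib

open Set

abbrev Plane : Type := EuclideanSpace ℝ (Fin 2)

/-- The Voronoi cell of a generator `p` for a generating set `P`. -/
def cell (P : Set Plane) (p : Plane) : Set Plane :=
  {x : Plane | ∀ q ∈ P, dist x p ≤ dist x q}

/-- The set of nearest generators of `x` in `P`. -/
def nearest (P : Set Plane) (x : Plane) : Set Plane :=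
  {p ∈ P | ∀ q ∈ P, dist x p ≤ dist x q}

/-- The Voronoi vertex set: points with at least 3 nearest generators. -/
def vtx (P : Set Plane) : Set Plane :=
  {x : Plane | 3 ≤ (nearest P x).encard}

/-- The boundary of a point set: its points on the frontier of its convex hull. -/
def Bd (S : Set Plane) : Set Plane :=
  S ∩ frontier (convexHull ℝ S)

/-- The number of instances of cocircularity. -/
noncomputable def Ic (P : Set Plane) : ℤ :=
  ∑ᶠ x ∈ vtx P, (((nearest P x).ncard : ℤ) - 3)

/-- Twice the signed area of the triangle `a b q`. -/
def cross (a b q : Plane) : ℝ :=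
  (b 0 - a 0) * (q 1 - a 1) - (b 1 - a 1) * (q 0 - a 0)

/-- The inner product of `q - a` and `q - b`. -/
def dotAt (a b q : Plane) : ℝ :=
  (q 0 - a 0) * (q 0 - b 0) + (q 1 - a 1) * (q 1 - b 1)

/-- `b` follows `a` on the boundary of `P`, counterclockwise: all of `P` lies to the left of the line
from `a` to `b`, and no point of `P` lies strictly between `a` and `b`. -/
def IsNext (P : Set Plane) (a b : Plane) : Prop :=
  a ≠ b ∧ ∀ q ∈ P, 0 ≤ cross a b q ∧ (cross a b q = 0 → 0 ≤ dotAt a b q)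

/-- A parametrization of the perpendicular bisector of `a` and `b`. -/
noncomputable def bisector (a b : Plane) (t : ℝ) : Plane :=
  !₂[(a 0 + b 0) / 2 + t * (b 1 - a 1), (a 1 + b 1) / 2 - t * (b 0 - a 0)]

lemma plane_ext {a b : Plane} (h0 : a 0 = b 0) (h1 : a 1 = b 1) : a = b := by
  ext i
  fin_cases i
  · exact h0
  · exact h1

lemma dist_le_dist_iff (x p q : Plane) : dist x p ≤ dist x q ↔
    (x 0 - p 0) ^ 2 + (x 1 - p 1) ^ 2 ≤ (x 0 - q 0) ^ 2 + (x 1 - q 1) ^ 2 := by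
  rw [EuclideanSpace.dist_eq, EuclideanSpace.dist_eq, Real.sqrt_le_sqrt_iff (by positivity)]
  simp [Fin.sum_univ_two, Real.dist_eq, sq_abs]

lemma normSq_sub_pos {a b : Plane} (h : a ≠ b) : 0 < (b 0 - a 0) ^ 2 + (b 1 - a 1) ^ 2 := by
  by_contra! hle
  have h0 : (b 0 - a 0) ^ 2 = 0 := by nlinarith [sq_nonneg (b 0 - a 0), sq_nonneg (b 1 - a 1)]
  have h1 : (b 1 - a 1) ^ 2 = 0 := by nlinarith [sq_nonneg (b 0 - a 0), sq_nonneg (b 1 - a 1)]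
  rw [sq_eq_zero_iff] at h0 h1
  exact h (plane_ext (by linarith) (by linarith))

/-- A vector orthogonal to the quarter turn of a nonzero vector is a multiple of that vector. -/
lemma exists_mul_of_det_eq_zero {u v x y : ℝ} (h : 0 < u ^ 2 + v ^ 2) (hc : u * y - v * x = 0) :
    ∃ c : ℝ, x = c * u ∧ y = c * v := by
  refine ⟨(u * x + v * y) / (u ^ 2 + v ^ 2), ?_, ?_⟩
  · field_simp
    linear_combination -v * hc
  · field_simp
    linear_combination u * hc

lemma exists_mul_of_cross_eq_zero {a b q : Plane} (h : a ≠ b) (hc : cross a b q = 0) :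
    ∃ c : ℝ, q 0 - a 0 = c * (b 0 - a 0) ∧ q 1 - a 1 = c * (b 1 - a 1) :=
  exists_mul_of_det_eq_zero (normSq_sub_pos h) hc

lemma collinear_of_cross_eq_zero {P : Set Plane} {a b : Plane} (h : a ≠ b)
    (hc : ∀ q ∈ P, cross a b q = 0) : Collinear ℝ P := by
  rw [collinear_iff_exists_forall_eq_smul_vadd]
  refine ⟨a, b - a, fun q hq => ?_⟩
  obtain ⟨c, h0, h1⟩ := exists_mul_of_cross_eq_zero h (hc q hq)
  refine ⟨c, plane_ext ?_ ?_⟩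
  · simp only [vadd_eq_add, PiLp.add_apply, PiLp.smul_apply, PiLp.sub_apply, smul_eq_mul]
    linarith
  · simp only [vadd_eq_add, PiLp.add_apply, PiLp.smul_apply, PiLp.sub_apply, smul_eq_mul]
    linarith

lemma bisector_mem_cell_inter_iff (P : Set Plane) (a b : Plane) (t : ℝ) :
    bisector a b t ∈ cell P a ∩ cell P b ↔
      ∀ q ∈ P, 0 ≤ dotAt a b q + 2 * t * cross a b q := by
  have ha : ∀ q, dist (bisector a b t) a ≤ dist (bisector a b t) q ↔
      0 ≤ dotAt a b q + 2 * t * cross a b q := by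
    intro q
    rw [dist_le_dist_iff, ← sub_nonneg]
    refine Eq.to_iff (congrArg _ ?_)
    simp [bisector, dotAt, cross]
    ring
  have hb : ∀ q, dist (bisector a b t) b ≤ dist (bisector a b t) q ↔
      0 ≤ dotAt a b q + 2 * t * cross a b q := by
    intro q
    rw [dist_le_dist_iff, ← sub_nonneg]
    refine Eq.to_iff (congrArg _ ?_)
    simp [bisector, dotAt, cross]
    ring
  simp only [cell, mem_inter_iff, mem_ofPred_eq, ha, hb, and_self]

lemma exists_eq_bisector {P : Set Plane} {a b x : Plane} (ha : a ∈ P) (hb : b ∈ P) (hab : a ≠ b)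
    (hx : x ∈ cell P a ∩ cell P b) : ∃ t, x = bisector a b t := by
  have h1 := (dist_le_dist_iff _ _ _).1 (hx.1 b hb)
  have h2 := (dist_le_dist_iff _ _ _).1 (hx.2 a ha)
  have hpos := normSq_sub_pos hab
  obtain ⟨t, h3, h4⟩ := exists_mul_of_det_eq_zero (u := b 1 - a 1) (v := -(b 0 - a 0))
    (x := x 0 - (a 0 + b 0) / 2) (y := x 1 - (a 1 + b 1) / 2) (by linarith) (by linarith)
  refine ⟨t, plane_ext ?_ ?_⟩ <;> simp [bisector] <;> linarith

lemma continuous_bisector (a b : Plane) : Continuous (bisector a b) := by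
  unfold bisector
  fun_prop

lemma bisector_neg (a b : Plane) (t : ℝ) : bisector a b (-t) = bisector b a t := by
  refine plane_ext ?_ ?_ <;> simp [bisector] <;> ring

lemma isNext_of_forall_exists {P : Set Plane} {a b : Plane} (hab : a ≠ b)
    (h : ∀ T : ℝ, ∃ t, T ≤ t ∧ bisector a b t ∈ cell P a ∩ cell P b) : IsNext P a b := by
  refine ⟨hab, fun q hq => ⟨?_, fun hc => ?_⟩⟩
  · by_contra! hneg
    obtain ⟨t, ht, hmem⟩ := h ((|dotAt a b q| + 1) / (-cross a b q))
    have h1 := (bisector_mem_cell_inter_iff P a b t).1 hmem q hq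
    rw [div_le_iff₀ (by linarith)] at ht
    linarith [le_abs_self (dotAt a b q), abs_nonneg (dotAt a b q)]
  · obtain ⟨t, -, hmem⟩ := h 0
    have h1 := (bisector_mem_cell_inter_iff P a b t).1 hmem q hq
    simpa [hc] using h1

lemma isNext_or_isNext_of_not_isBounded {P : Set Plane} {a b : Plane} (ha : a ∈ P) (hb : b ∈ P)
    (hab : a ≠ b) (h : ¬ Bornology.IsBounded (cell P a ∩ cell P b)) :
    IsNext P a b ∨ IsNext P b a := by
  by_contra! hno
  have h1 := mt (isNext_of_forall_exists hab) hno.1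
  have h2 := mt (isNext_of_forall_exists hab.symm) hno.2
  push Not at h1 h2
  obtain ⟨T, hT⟩ := h1
  obtain ⟨S, hS⟩ := h2
  refine h ((((isCompact_Icc (a := -S) (b := T)).image (continuous_bisector a b)).isBounded).subset
    fun x hx => ?_)
  obtain ⟨t, rfl⟩ := exists_eq_bisector ha hb hab hx
  refine ⟨t, ⟨?_, ?_⟩, rfl⟩
  · by_contra! hlt
    refine hS (-t) (by linarith) ?_
    rw [bisector_neg, inter_comm]
    exact hx
  · by_contra! hlt
    exact hT t hlt.le hx

lemma not_isBounded_of_isNext {P : Set Plane} (hP : P.Finite) {a b : Plane} (h : IsNext P a b) :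
    ¬ Bornology.IsBounded (cell P a ∩ cell P b) := by
  intro hbd
  have hev : ∀ᶠ t : ℝ in Filter.atTop, bisector a b t ∈ cell P a ∩ cell P b := by
    simp only [bisector_mem_cell_inter_iff]
    refine (Filter.eventually_all_finite hP).2 fun q hq => ?_
    obtain ⟨h0, h1⟩ := h.2 q hq
    rcases h0.eq_or_lt with hc | hc
    · refine Filter.Eventually.of_forall fun t => ?_
      simpa [← hc] using h1 hc.symm
    · filter_upwards [Filter.eventually_ge_atTop (|dotAt a b q| / (2 * cross a b q))] with t ht
      rw [div_le_iff₀ (by linarith)] at ht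
      linarith [neg_abs_le (dotAt a b q)]
  obtain ⟨C, hC⟩ := Metric.isBounded_iff.1 hbd
  obtain ⟨T, hT⟩ := Filter.eventually_atTop.1 hev
  have hpos := normSq_sub_pos h.1
  set N := (b 0 - a 0) ^ 2 + (b 1 - a 1) ^ 2 with hN
  have hdist : ∀ s : ℝ, dist (bisector a b (T + s)) (bisector a b T) = √ (s ^ 2 * N) := by
    intro s
    rw [EuclideanSpace.dist_eq]
    congr 1
    simp [Fin.sum_univ_two, Real.dist_eq, sq_abs, bisector, hN]
    ring
  have hs : (0 : ℝ) ≤ (|C| + 1) / √ N := by positivity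
  have h1 := hC (hT (T + (|C| + 1) / √ N) (by linarith)) (hT T le_rfl)
  rw [hdist, Real.sqrt_mul (sq_nonneg _), Real.sqrt_sq hs,
    div_mul_cancel₀ _ (Real.sqrt_pos.2 hpos).ne'] at h1
  linarith [le_abs_self C]

lemma not_isNext_symm {P : Set Plane} (hcol : ¬ Collinear ℝ P) {a b : Plane}
    (h : IsNext P a b) : ¬ IsNext P b a := by
  intro h'
  refine hcol (collinear_of_cross_eq_zero h.1 fun q hq => le_antisymm ?_ (h.2 q hq).1)
  have h1 := (h'.2 q hq).1
  unfold cross at h1 ⊢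
  linarith

lemma isNext_right_unique {P : Set Plane} (hcol : ¬ Collinear ℝ P) {p a b : Plane}
    (ha : a ∈ P) (hb : b ∈ P) (h : IsNext P p a) (h' : IsNext P p b) : a = b := by
  have hsymm : cross p b a = -cross p a b := by unfold cross; ring
  have hc : cross p a b = 0 := by linarith [(h.2 b hb).1, (h'.2 a ha).1]
  obtain ⟨c, h0, h1⟩ := exists_mul_of_cross_eq_zero h.1 hc
  have hpos := normSq_sub_pos h.1
  have hd1 := (h.2 b hb).2 hc
  have hd2 := (h'.2 a ha).2 (by linarith)
  have e1 : dotAt p a b = c * (c - 1) * ((a 0 - p 0) ^ 2 + (a 1 - p 1) ^ 2) := by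
    have e0 : b 0 - a 0 = (c - 1) * (a 0 - p 0) := by linarith
    have e1 : b 1 - a 1 = (c - 1) * (a 1 - p 1) := by linarith
    rw [dotAt, h0, h1, e0, e1]
    ring
  have e2 : dotAt p b a = (1 - c) * ((a 0 - p 0) ^ 2 + (a 1 - p 1) ^ 2) := by
    have e0 : a 0 - b 0 = (1 - c) * (a 0 - p 0) := by linarith
    have e1 : a 1 - b 1 = (1 - c) * (a 1 - p 1) := by linarith
    rw [dotAt, e0, e1]
    ring
  rw [e1] at hd1
  rw [e2] at hd2
  have k1 := nonneg_of_mul_nonneg_left hd1 hpos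
  have k2 := nonneg_of_mul_nonneg_left hd2 hpos
  by_contra hne
  have hc1 : c < 1 := by
    refine lt_of_le_of_ne (by linarith) fun hc1 => hne ?_
    subst hc1
    exact plane_ext (by linarith) (by linarith)
  have hc0 : c ≤ 0 := by nlinarith
  have hcneg : c < 0 := by
    refine lt_of_le_of_ne hc0 fun hc1 => h'.1 ?_
    subst hc1
    exact plane_ext (by linarith) (by linarith)
  refine hcol (collinear_of_cross_eq_zero h.1 fun q hq => le_antisymm ?_ (h.2 q hq).1)
  have k3 := (h'.2 q hq).1
  have e3 : cross p b q = c * cross p a q := by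
    unfold cross
    rw [h0, h1]
    ring
  rw [e3] at k3
  nlinarith

lemma mem_Bd_of_isNext {P : Set Plane} {a b : Plane} (ha : a ∈ P) (h : IsNext P a b) :
    a ∈ Bd P := by
  refine ⟨ha, subset_closure (subset_convexHull ℝ P ha), fun hint => ?_⟩
  have hpos := normSq_sub_pos h.1
  have hsub : convexHull ℝ P ⊆ {q | 0 ≤ cross a b q} := by
    refine convexHull_min (fun q hq => (h.2 q hq).1) ?_
    intro x hx y hy s t hs ht hst
    have e : cross a b (s • x + t • y) = s * cross a b x + t * cross a b y := by
      have : s = 1 - t := by linarith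
      subst this
      simp [cross]
      ring
    simp only [mem_ofPred_eq] at hx hy ⊢
    rw [e]
    positivity
  have hcont : Continuous fun t : ℝ =>
      (!₂[a 0 + t * (b 1 - a 1), a 1 - t * (b 0 - a 0)] : Plane) := by fun_prop
  have h0 : (!₂[a 0 + 0 * (b 1 - a 1), a 1 - 0 * (b 0 - a 0)] : Plane) = a := by
    refine plane_ext ?_ ?_ <;> simp
  have hev : ∀ᶠ t in nhds (0 : ℝ),
      (!₂[a 0 + t * (b 1 - a 1), a 1 - t * (b 0 - a 0)] : Plane) ∈ interior (convexHull ℝ P) :=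
    hcont.continuousAt.eventually_mem (isOpen_interior.mem_nhds (by rwa [h0]))
  obtain ⟨ε, hε, hball⟩ := Metric.eventually_nhds_iff.1 hev
  have hm := hsub (interior_subset (hball (y := ε / 2)
    (by rw [Real.dist_eq, sub_zero, abs_of_pos (by linarith)]; linarith)))
  simp only [mem_ofPred_eq, cross] at hm
  simp at hm
  nlinarith

lemma interior_convexHull_nonempty {P : Set Plane} (hcol : ¬ Collinear ℝ P) :
    (interior (convexHull ℝ P)).Nonempty := by
  rw [interior_convexHull_nonempty_iff_affineSpan_eq_top]
  have hne : P.Nonempty := by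
    rw [nonempty_iff_ne_empty]
    rintro rfl
    exact hcol (collinear_empty ℝ Plane)
  rw [collinear_iff_finrank_le_one, not_le] at hcol
  rw [← AffineSubspace.direction_eq_top_iff_of_nonempty ((affineSpan_nonempty ℝ).2 hne),
    direction_affineSpan]
  refine Submodule.eq_top_of_finrank_eq (le_antisymm (Submodule.finrank_le _) ?_)
  simp only [finrank_euclideanSpace, Fintype.card_fin]
  exact hcol

/-- A point of `Bd P` admits a supporting line. -/
lemma exists_support_of_mem_Bd {P : Set Plane} (hcol : ¬ Collinear ℝ P)
    {p : Plane} (hp : p ∈ Bd P) :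
    ∃ α β : ℝ, 0 < α ^ 2 + β ^ 2 ∧ ∀ q ∈ P, 0 ≤ α * (q 0 - p 0) + β * (q 1 - p 1) := by
  have hconv : Convex ℝ (convexHull ℝ P) := convex_convexHull ℝ P
  have hne := interior_convexHull_nonempty hcol
  obtain ⟨f, hf⟩ := geometric_hahn_banach_open_point hconv.interior isOpen_interior hp.2.2
  have hle : ∀ q ∈ P, f q ≤ f p := by
    intro q hq
    have hq' : q ∈ closure (interior (convexHull ℝ P)) := by
      rw [hconv.closure_interior_eq_closure_of_nonempty_interior hne]
      exact subset_closure (subset_convexHull ℝ P hq)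
    have hcl : closure (interior (convexHull ℝ P)) ⊆ {x | f x ≤ f p} :=
      closure_minimal (fun x hx => (hf x hx).le) (isClosed_le f.continuous continuous_const)
    exact hcl hq'
  have hcoord : ∀ x : Plane, f x = x 0 * f !₂[1, 0] + x 1 * f !₂[0, 1] := by
    intro x
    have hx : x = x 0 • (!₂[1, 0] : Plane) + x 1 • (!₂[0, 1] : Plane) := by
      refine plane_ext ?_ ?_ <;> simp
    conv_lhs => rw [hx]
    simp only [map_add, map_smul, smul_eq_mul]
  refine ⟨-f !₂[1, 0], -f !₂[0, 1], ?_, fun q hq => ?_⟩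
  · by_contra! hz
    obtain ⟨x, hx⟩ := hne
    have h0 : f !₂[1, 0] = 0 := by nlinarith [sq_nonneg (f !₂[1, 0]), sq_nonneg (f !₂[0, 1])]
    have h1 : f !₂[0, 1] = 0 := by nlinarith [sq_nonneg (f !₂[1, 0]), sq_nonneg (f !₂[0, 1])]
    have := hf x hx
    rw [hcoord x, hcoord p, h0, h1] at this
    simp at this
  · have := hle q hq
    rw [hcoord q, hcoord p] at this
    linarith

lemma det_nonneg_of_arg_le {z w : ℂ} (hz : 0 ≤ z.im) (h : z.arg ≤ w.arg) :
    0 ≤ z.re * w.im - z.im * w.re := by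
  have e : z.re * w.im - z.im * w.re = ‖z‖ * ‖w‖ * Real.sin (w.arg - z.arg) := by
    rw [Real.sin_sub]
    linear_combination -(w.im * Complex.norm_mul_cos_arg z) + w.re * Complex.norm_mul_sin_arg z -
      ‖z‖ * Real.cos z.arg * Complex.norm_mul_sin_arg w +
      ‖z‖ * Real.sin z.arg * Complex.norm_mul_cos_arg w
  rw [e]
  have h1 := Complex.arg_nonneg_iff.2 hz
  have h2 := Complex.arg_le_pi w
  have := Real.sin_nonneg_of_nonneg_of_le_pi (x := w.arg - z.arg) (by linarith) (by linarith)
  positivity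

lemma exists_isNext_of_mem_Bd {P : Set Plane} (hP : P.Finite) (hcol : ¬ Collinear ℝ P)
    {p : Plane} (hp : p ∈ Bd P) : ∃ a ∈ P, IsNext P p a := by
  obtain ⟨α, β, hpos, hsupp⟩ := exists_support_of_mem_Bd hcol hp
  let z : Plane → ℂ := fun q =>
    ⟨β * (q 0 - p 0) - α * (q 1 - p 1), α * (q 0 - p 0) + β * (q 1 - p 1)⟩
  have hne : (P \ {p}).Nonempty := by
    rw [nonempty_iff_ne_empty, Ne, sdiff_eq_empty]
    exact fun h => hcol ((collinear_singleton ℝ p).subset h)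
  obtain ⟨a, ⟨haP, hap⟩, hmin⟩ :=
    exists_min_image (P \ {p}) (fun q => toLex ((z q).arg, ‖z q‖)) hP.sdiff hne
  have hpa : p ≠ a := fun h => hap h.symm
  have hNpos := normSq_sub_pos hpa
  refine ⟨a, haP, hpa, fun q hq => ?_⟩
  rcases eq_or_ne q p with rfl | hqp
  · simp [cross, dotAt]
  have hm := Prod.Lex.toLex_le_toLex.1 (hmin q ⟨hq, hqp⟩)
  refine ⟨?_, fun hc => ?_⟩
  · have harg : (z a).arg ≤ (z q).arg := by
      rcases hm with h | h
      · exact h.le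
      · exact h.1.le
    have hd := det_nonneg_of_arg_le (hsupp a haP) harg
    have e : (z a).re * (z q).im - (z a).im * (z q).re = (α ^ 2 + β ^ 2) * cross p a q := by
      simp only [z, cross]
      ring
    rw [e] at hd
    exact nonneg_of_mul_nonneg_right hd hpos
  · obtain ⟨c, h0, h1⟩ := exists_mul_of_cross_eq_zero hpa hc
    have e1 : dotAt p a q = c * (c - 1) * ((a 0 - p 0) ^ 2 + (a 1 - p 1) ^ 2) := by
      have e0 : q 0 - a 0 = (c - 1) * (a 0 - p 0) := by linarith
      have e1 : q 1 - a 1 = (c - 1) * (a 1 - p 1) := by linarith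
      rw [dotAt, h0, h1, e0, e1]
      ring
    by_contra! hneg
    have hcc : c * (c - 1) < 0 := by
      by_contra! hcc
      rw [e1] at hneg
      linarith [mul_nonneg hcc hNpos.le]
    have hc0 : 0 < c := by nlinarith
    have hc1 : c < 1 := by nlinarith
    have hz : z q = (c : ℂ) * z a := by
      apply Complex.ext
      · simp only [z, Complex.re_ofReal_mul, h0, h1]
        ring
      · simp only [z, Complex.im_ofReal_mul, h0, h1]
        ring
    have hza : z a ≠ 0 := by
      intro hza
      have hre := congrArg Complex.re hza
      have him := congrArg Complex.im hza
      simp only [z, Complex.zero_re, Complex.zero_im] at hre him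
      have : (α ^ 2 + β ^ 2) * ((a 0 - p 0) ^ 2 + (a 1 - p 1) ^ 2) = 0 := by
        linear_combination (β * (a 0 - p 0) - α * (a 1 - p 1)) * hre +
          (α * (a 0 - p 0) + β * (a 1 - p 1)) * him
      exact (mul_pos hpos hNpos).ne' this
    have hna : 0 < ‖z a‖ := norm_pos_iff.2 hza
    rw [hz, Complex.arg_real_mul _ hc0, norm_mul, Complex.norm_real, Real.norm_of_nonneg hc0.le]
      at hm
    rcases hm with h | h
    · exact lt_irrefl _ h
    · nlinarith [h.2]

theorem card_infinite_edges_eq_card_bd (P : Set Plane) (hP : P.Finite)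
    (hcol : ¬ Collinear ℝ P) :
    {e : Set Plane | ∃ p ∈ P, ∃ p' ∈ P, p ≠ p' ∧ e = {p, p'} ∧
      (cell P p ∩ cell P p').Nontrivial ∧
      ¬ Bornology.IsBounded (cell P p ∩ cell P p')}.ncard = (Bd P).ncard := by
  have hfst : BijOn Prod.fst {x : Plane × Plane | x.1 ∈ P ∧ x.2 ∈ P ∧ IsNext P x.1 x.2} (Bd P) := by
    refine ⟨?_, ?_, ?_⟩
    · rintro ⟨a, b⟩ ⟨ha, -, h⟩
      exact mem_Bd_of_isNext ha h
    · rintro ⟨a, b⟩ ⟨-, hb, h⟩ ⟨a', b'⟩ ⟨-, hb', h'⟩ (rfl : a = a')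
      exact Prod.ext rfl (isNext_right_unique hcol hb hb' h h')
    · intro p hp
      obtain ⟨a, ha, h⟩ := exists_isNext_of_mem_Bd hP hcol hp
      exact ⟨(p, a), ⟨hp.1, ha, h⟩, rfl⟩
  have hpair : BijOn (fun x : Plane × Plane => ({x.1, x.2} : Set Plane))
      {x : Plane × Plane | x.1 ∈ P ∧ x.2 ∈ P ∧ IsNext P x.1 x.2}
      {e : Set Plane | ∃ p ∈ P, ∃ p' ∈ P, p ≠ p' ∧ e = {p, p'} ∧
        (cell P p ∩ cell P p').Nontrivial ∧
        ¬ Bornology.IsBounded (cell P p ∩ cell P p')} := by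
    refine ⟨?_, ?_, ?_⟩
    · rintro ⟨a, b⟩ ⟨ha, hb, h⟩
      have hub := not_isBounded_of_isNext hP h
      refine ⟨a, ha, b, hb, h.1, rfl, ?_, hub⟩
      rw [← not_subsingleton_iff]
      exact fun hs => hub (Set.Subsingleton.finite hs).isBounded
    · rintro ⟨a, b⟩ ⟨-, -, h⟩ ⟨c, d⟩ ⟨-, -, h'⟩ heq
      rcases Set.pair_eq_pair_iff.1 heq with ⟨h1, h2⟩ | ⟨h1, h2⟩
      · exact Prod.ext h1 h2
      · simp only at h1 h2 h h'
        subst h1 h2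
        exact absurd h' (not_isNext_symm hcol h)
    · rintro e ⟨p, hp, p', hp', hne, rfl, -, hub⟩
      rcases isNext_or_isNext_of_not_isBounded hp hp' hne hub with h | h
      · exact ⟨(p, p'), ⟨hp, hp', h⟩, rfl⟩
      · exact ⟨(p', p), ⟨hp', hp, h⟩, Set.pair_comm _ _⟩
  rw [← hpair.image_eq, hpair.injOn.ncard_image, ← hfst.image_eq,
    hfst.injOn.ncard_image]
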